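/- Correctness of the rotation-based inner sum: let n = 2^k for a natural number k, and let v : ZMod n → ℂ be a vector of n slots. Define one rotation-and-add step with shift t by (step t w)(j) = w(j) + w(j + t) for all j in ZMod n. Then applying the steps with shifts 2^0, 2^1, ..., 2^(k-1) in order (i.e., the composite step 2^(k-1) ∘ ... ∘ step 2 ∘ step 1 applied to v) produces a vector whose every slot equals the sum of all slots of v: for every j in ZMod n, the resulting vector at j equals Σ_{i ∈ ZMod n} v(i). -/

import Mathlib

/-- One rotation-and-add step with shift `t`: slot `j` of the result is
`w j + w (j + t)`. -/
def rotStep {n : ℕ} (t : ZMod n) (w : ZMod n → ℂ) : ZMod n → ℂ :=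
  fun j => w j + w (j + t)

/-- After the steps with shifts `2^0, …, 2^(m-1)`, slot `j` holds the sum of the `2^m`
consecutive slots of `v` starting at `j`. -/
theorem foldl_rotStep_apply {n : ℕ} (v : ZMod n → ℂ) (m : ℕ) (j : ZMod n) :
    ((List.range m).foldl (fun w i => rotStep ((2 ^ i : ℕ) : ZMod n) w) v) j
      = ∑ i ∈ Finset.range (2 ^ m), v (j + i) := by
  induction m generalizing j with
  | zero => simp
  | succ m ih =>
    simp only [List.range_succ, List.foldl_append, List.foldl_cons, List.foldl_nil, rotStep, ih,
      pow_succ, mul_two, Finset.sum_range_add, Nat.cast_add, add_assoc]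

theorem ZMod.sum_range_natCast {n : ℕ} [NeZero n] {M : Type*} [AddCommMonoid M]
    (f : ZMod n → M) : ∑ i ∈ Finset.range n, f i = ∑ i, f i :=
  Finset.sum_bij' (fun i _ => (i : ZMod n)) (fun i _ => i.val) (by simp)
    (by simp [ZMod.val_lt]) (fun i hi => ZMod.val_cast_of_lt (Finset.mem_range.mp hi))
    (by simp) (by simp)

/-- Correctness of the rotation-based inner sum: for `n = 2^k`, applying the
rotation-and-add steps with shifts `2^0, 2^1, …, 2^(k-1)` in order to a vector
`v : ZMod n → ℂ` yields a vector whose every slot equals the sum of all slots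
of `v`. -/
theorem innerSum_correct (k : ℕ) (v : ZMod (2 ^ k) → ℂ) (j : ZMod (2 ^ k)) :
    ((List.range k).foldl (fun w m => rotStep ((2 ^ m : ℕ) : ZMod (2 ^ k)) w) v) j
      = ∑ i : ZMod (2 ^ k), v i := by
  rw [foldl_rotStep_apply, ZMod.sum_range_natCast (fun i => v (j + i))]
  exact Equiv.sum_comp (Equiv.addLeft j) v
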